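/- Let $k>0$, let $a<b$ be real numbers, and let $U:(a,b)\to \mathrm{Mat}_{n\times n}(\mathbb{R})$ be a differentiable matrix-valued function such that $U(t)$ is symmetric for every $t\in(a,b)$ and $U$ solves the Riccati equation $U'(t)+U(t)^2+R(t)=0$ on $(a,b)$, where $R(t)$ is symmetric and $R(t)+k^2\,\mathrm{Id}$ is positive semidefinite for every $t\in(a,b)$. Fix $x\in\mathbb{R}^n$, $t_0\in(a,b)$, and $d<t_0$. If $\langle U(t_0)x,x\rangle < k\coth(k(t_0-d))\,\|x\|^2$, then for every $t\in[t_0,b)$ one has $\langle U(t)x,x\rangle < k\coth(k(t-d))\,\|x\|^2$. -/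

import Mathlib

open Matrix Set

/-- The hyperbolic cotangent. -/
noncomputable def coth (s : ℝ) : ℝ := Real.cosh s / Real.sinh s

/-- Nonnegativity of `‖c x - s y‖²`, expanded in dot products. -/
theorem sq_smul_sub_smul_nonneg {n : ℕ} (c s : ℝ) (x y : Fin n → ℝ) :
    0 ≤ c ^ 2 * (x ⬝ᵥ x) - 2 * c * s * (y ⬝ᵥ x) + s ^ 2 * (y ⬝ᵥ y) := by
  have h : c ^ 2 * (x ⬝ᵥ x) - 2 * c * s * (y ⬝ᵥ x) + s ^ 2 * (y ⬝ᵥ y)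
      = ∑ i, (c * x i - s * y i) ^ 2 := by
    simp only [dotProduct, Finset.mul_sum, ← Finset.sum_sub_distrib, ← Finset.sum_add_distrib]
    exact Finset.sum_congr rfl fun i _ => by ring
  rw [h]
  positivity

/-- Entrywise differentiability gives differentiability of the quadratic form. -/
theorem hasDerivAt_mulVec_dotProduct {n : ℕ} {U : ℝ → Matrix (Fin n) (Fin n) ℝ}
    {A : Matrix (Fin n) (Fin n) ℝ} {t : ℝ}
    (h : ∀ i j, HasDerivAt (fun s => U s i j) (A i j) t) (x : Fin n → ℝ) :
    HasDerivAt (fun s => (U s *ᵥ x) ⬝ᵥ x) ((A *ᵥ x) ⬝ᵥ x) t := by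
  simp only [mulVec, dotProduct]
  exact HasDerivAt.fun_sum fun i _ =>
    (HasDerivAt.fun_sum fun j _ => (h i j).mul_const (x j)).mul_const (x i)

/-- The derivative bound for the quadratic form of a symmetric Riccati solution. -/
theorem riccati_mulVec_dotProduct_le {n : ℕ} {k : ℝ} {A B R : Matrix (Fin n) (Fin n) ℝ}
    (hA : Aᵀ = A) (h : B + A ^ 2 + R = 0) (x : Fin n → ℝ)
    (hR : 0 ≤ ((R + (k ^ 2) • (1 : Matrix (Fin n) (Fin n) ℝ)) *ᵥ x) ⬝ᵥ x) :
    (B *ᵥ x) ⬝ᵥ x ≤ k ^ 2 * (x ⬝ᵥ x) - (A *ᵥ x) ⬝ᵥ (A *ᵥ x) := by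
  have hsq : ((A ^ 2) *ᵥ x) ⬝ᵥ x = (A *ᵥ x) ⬝ᵥ (A *ᵥ x) := by
    rw [dotProduct_mulVec, ← mulVec_transpose, hA, mulVec_mulVec, sq]
  have h0 : ((B + A ^ 2 + R) *ᵥ x) ⬝ᵥ x = 0 := by simp [h]
  simp only [add_mulVec, add_dotProduct, smul_mulVec, one_mulVec, smul_dotProduct,
    smul_eq_mul] at h0 hR
  linarith

/-- If a symmetric Riccati solution lies strictly below the model solution
`k coth(k(t-d))` at some time `t₀ > d`, it stays strictly below it for all later times. -/
theorem riccati_comparison_forward {n : ℕ} (k a b : ℝ) (hk : 0 < k) (hab : a < b)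
    (U U' R : ℝ → Matrix (Fin n) (Fin n) ℝ)
    (hderiv : ∀ t ∈ Ioo a b, ∀ i j, HasDerivAt (fun s => U s i j) (U' t i j) t)
    (hUsymm : ∀ t ∈ Ioo a b, (U t)ᵀ = U t)
    (hric : ∀ t ∈ Ioo a b, U' t + U t ^ 2 + R t = 0)
    (hRsymm : ∀ t ∈ Ioo a b, (R t)ᵀ = R t)
    (hRpsd : ∀ t ∈ Ioo a b, ∀ x : Fin n → ℝ,
      0 ≤ ((R t + (k ^ 2) • (1 : Matrix (Fin n) (Fin n) ℝ)) *ᵥ x) ⬝ᵥ x)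
    (x : Fin n → ℝ) (t₀ : ℝ) (ht₀ : t₀ ∈ Ioo a b) (d : ℝ) (hd : d < t₀)
    (hinit : (U t₀ *ᵥ x) ⬝ᵥ x < k * coth (k * (t₀ - d)) * (x ⬝ᵥ x)) :
    ∀ t ∈ Ico t₀ b, (U t *ᵥ x) ⬝ᵥ x < k * coth (k * (t - d)) * (x ⬝ᵥ x) := by
  have hlt : ∀ t, t₀ ≤ t → ((U t *ᵥ x) ⬝ᵥ x < k * coth (k * (t - d)) * (x ⬝ᵥ x) ↔
      0 < k * Real.cosh (k * (t - d)) * Real.sinh (k * (t - d)) * (x ⬝ᵥ x)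
        - Real.sinh (k * (t - d)) ^ 2 * ((U t *ᵥ x) ⬝ᵥ x)) := by
    intro t ht
    have hs : 0 < Real.sinh (k * (t - d)) :=
      Real.sinh_pos_iff.2 (mul_pos hk (by linarith))
    have hfac : k * Real.cosh (k * (t - d)) * Real.sinh (k * (t - d)) * (x ⬝ᵥ x)
        - Real.sinh (k * (t - d)) ^ 2 * ((U t *ᵥ x) ⬝ᵥ x)
        = Real.sinh (k * (t - d)) ^ 2 *
          (k * coth (k * (t - d)) * (x ⬝ᵥ x) - (U t *ᵥ x) ⬝ᵥ x) := by
      unfold coth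
      field_simp
    rw [hfac, mul_pos_iff_of_pos_left (by positivity), sub_pos]
  have hd' : ∀ t ∈ Ioo a b, HasDerivAt
      (fun t => k * Real.cosh (k * (t - d)) * Real.sinh (k * (t - d)) * (x ⬝ᵥ x)
        - Real.sinh (k * (t - d)) ^ 2 * ((U t *ᵥ x) ⬝ᵥ x))
      (k ^ 2 * (Real.cosh (k * (t - d)) ^ 2 + Real.sinh (k * (t - d)) ^ 2) * (x ⬝ᵥ x)
        - 2 * (k * Real.cosh (k * (t - d))) * Real.sinh (k * (t - d)) * ((U t *ᵥ x) ⬝ᵥ x)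
        - Real.sinh (k * (t - d)) ^ 2 * ((U' t *ᵥ x) ⬝ᵥ x)) t := by
    intro t ht
    have hlin : HasDerivAt (fun t => k * (t - d)) k t := by
      simpa using ((hasDerivAt_id t).sub_const d).const_mul k
    have hq := hasDerivAt_mulVec_dotProduct (hderiv t ht) x
    refine ((((hlin.cosh.const_mul k).fun_mul hlin.sinh).mul_const (x ⬝ᵥ x)).fun_sub
      ((hlin.sinh.fun_pow 2).fun_mul hq)).congr_deriv ?_
    push_cast
    ring
  have hmono : MonotoneOn
      (fun t => k * Real.cosh (k * (t - d)) * Real.sinh (k * (t - d)) * (x ⬝ᵥ x)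
        - Real.sinh (k * (t - d)) ^ 2 * ((U t *ᵥ x) ⬝ᵥ x)) (Ioo a b) := by
    refine monotoneOn_of_hasDerivWithinAt_nonneg (convex_Ioo a b)
      (fun t ht => (hd' t ht).continuousAt.continuousWithinAt)
      (fun t ht => (hd' t (interior_subset ht)).hasDerivWithinAt) fun t ht => ?_
    have ht' := interior_subset ht
    have hle := mul_le_mul_of_nonneg_left
      (riccati_mulVec_dotProduct_le (hUsymm t ht') (hric t ht') x (hRpsd t ht' x))
      (sq_nonneg (Real.sinh (k * (t - d))))
    have hnn := sq_smul_sub_smul_nonneg (k * Real.cosh (k * (t - d)))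
      (Real.sinh (k * (t - d))) x (U t *ᵥ x)
    linarith
  intro t ht
  exact (hlt t ht.1).2 (((hlt t₀ le_rfl).1 hinit).trans_le
    (hmono ht₀ ⟨ht₀.1.trans_le ht.1, ht.2⟩ ht.1))
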